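/- Let A and B be Banach algebras and φ : A → B a continuous algebra homomorphism with dense range. Let I be a closed two-sided ideal of A and J a closed two-sided ideal of B such that φ(I) ⊆ J. If A has a bounded approximate identity modulo I, then B has a bounded approximate identity modulo J. -/

import Mathlib

open Filter Topology

/-- `A` (with fundamental system of seminorms `p`) has a bounded approximate identity
modulo `I`: a bounded net `(e_i)` with `p n (a * e i - a) → 0` and `p n (e i * a - a) → 0`
for every `a ∈ A \ I` and every `n`. -/
def HasBAIModulo {A : Type*} [NonUnitalRing A] [Module ℝ A]
    (p : ℕ → Seminorm ℝ A) (I : Set A) : Prop :=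
  ∃ (ι : Type) (_ : Preorder ι) (_ : IsDirected ι (· ≤ ·)) (_ : Nonempty ι) (e : ι → A),
    (∀ n, ∃ C : ℝ, ∀ i, p n (e i) ≤ C) ∧
    ∀ a ∉ I, ∀ n : ℕ,
      Tendsto (fun i => p n (a * e i - a)) atTop (𝓝 (0 : ℝ)) ∧
      Tendsto (fun i => p n (e i * a - a)) atTop (𝓝 (0 : ℝ))

/-- A normed algebra `B` has a bounded approximate identity modulo `I`:
a norm-bounded net `(e_i)` with `‖b * e i - b‖ → 0` and `‖e i * b - b‖ → 0`
for every `b ∈ B \ I`. -/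
def HasBAIModuloNorm {B : Type*} [NonUnitalSeminormedRing B] (I : Set B) : Prop :=
  ∃ (ι : Type) (_ : Preorder ι) (_ : IsDirected ι (· ≤ ·)) (_ : Nonempty ι) (e : ι → B),
    (∃ C : ℝ, ∀ i, ‖e i‖ ≤ C) ∧
    ∀ b ∉ I,
      Tendsto (fun i => ‖b * e i - b‖) atTop (𝓝 (0 : ℝ)) ∧
      Tendsto (fun i => ‖e i * b - b‖) atTop (𝓝 (0 : ℝ))

/-- `A` (with fundamental system of seminorms `p`) has a locally bounded approximate
identity modulo `I`. -/
def HasLBAIModulo {A : Type*} [NonUnitalRing A] [Module ℝ A]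
    (p : ℕ → Seminorm ℝ A) (I : Set A) : Prop :=
  ∃ C : ℕ → ℝ, (∀ n, 0 < C n) ∧
    ∀ (F : Finset A), (∀ a ∈ F, a ∉ I) → ∀ n : ℕ, ∀ ε : ℝ, 0 < ε → ∃ b : A,
      p n b ≤ C n ∧ ∀ a ∈ F, p n (a * b - a) < ε ∧ p n (b * a - a) < ε

/-- `I` is a two-sided ideal (and an `ℝ`-subspace) of the algebra `A`. -/
def IsTwoSidedIdealSet (A : Type*) [NonUnitalRing A] [Module ℝ A] (I : Set A) : Prop :=
  (0 : A) ∈ I ∧ (∀ a ∈ I, ∀ b ∈ I, a + b ∈ I) ∧ (∀ (r : ℝ), ∀ a ∈ I, r • a ∈ I) ∧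
    (∀ (a : A), ∀ b ∈ I, a * b ∈ I) ∧ (∀ a ∈ I, ∀ (b : A), a * b ∈ I)

theorem tendsto_norm_sub_of_mem_closure {ι E : Type*} [SeminormedAddCommGroup E] {l : Filter ι}
    {T : ι → E →+ E} {K : ℝ} (hT : ∀ i x, ‖T i x‖ ≤ K * ‖x‖) {S : Set E}
    (hS : ∀ s ∈ S, Tendsto (fun i => ‖T i s - s‖) l (𝓝 0)) {b : E} (hb : b ∈ closure S) :
    Tendsto (fun i => ‖T i b - b‖) l (𝓝 0) := by
  rw [Metric.tendsto_nhds]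
  intro ε hε
  have hK : 0 < |K| + 1 := by positivity
  obtain ⟨s, hsS, hs⟩ := Metric.mem_closure_iff.1 hb (ε / 2 / (|K| + 1)) (by positivity)
  rw [dist_eq_norm, lt_div_iff₀ hK] at hs
  filter_upwards [(hS s hsS).eventually_lt_const (half_pos hε)] with i hi
  have hsplit : T i b - b = T i (b - s) + (T i s - s) - (b - s) := by
    rw [map_sub]
    abel
  have hTi : ‖T i (b - s)‖ ≤ |K| * ‖b - s‖ :=
    (hT i _).trans (mul_le_mul_of_nonneg_right (le_abs_self K) (norm_nonneg _))
  rw [dist_zero_right, norm_norm, hsplit]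
  linarith [norm_sub_le (T i (b - s) + (T i s - s)) (b - s),
    norm_add_le (T i (b - s)) (T i s - s)]

theorem tendsto_norm_map_sub {ι A B : Type*} [SeminormedAddCommGroup A]
    [SeminormedAddCommGroup B] {l : Filter ι} {f : A →+ B} (hf : Continuous f) {u : ι → A} {a : A}
    (hu : Tendsto (fun i => ‖u i - a‖) l (𝓝 0)) :
    Tendsto (fun i => ‖f (u i) - f a‖) l (𝓝 0) :=
  tendsto_iff_norm_sub_tendsto_zero.1
    ((hf.tendsto a).comp (tendsto_iff_norm_sub_tendsto_zero.2 hu))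

/-- Let `A` and `B` be Banach algebras and `φ : A → B` a continuous
algebra homomorphism with dense range.  Let `I` be a closed two-sided ideal of `A` and `J`
a closed two-sided ideal of `B` such that `φ(I) ⊆ J`.  If `A` has a bounded approximate
identity modulo `I`, then `B` has a bounded approximate identity modulo `J`. -/
theorem hasBAIModuloNorm_of_denseRange
    {A : Type*} [NonUnitalNormedRing A] [NormedSpace ℝ A]
    [SMulCommClass ℝ A A] [IsScalarTower ℝ A A] [CompleteSpace A]
    {B : Type*} [NonUnitalNormedRing B] [NormedSpace ℝ B]
    [SMulCommClass ℝ B B] [IsScalarTower ℝ B B] [CompleteSpace B]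
    (φ : A →ₙₐ[ℝ] B) (hφcont : Continuous φ) (hφdense : DenseRange φ)
    (I : Set A) (hI : IsTwoSidedIdealSet A I) (hIc : IsClosed I)
    (J : Set B) (hJ : IsTwoSidedIdealSet B J) (hJc : IsClosed J)
    (hφIJ : φ '' I ⊆ J)
    (hA : HasBAIModuloNorm I) :
    HasBAIModuloNorm J := by
  obtain ⟨ι, _, _, _, e, ⟨C, hC⟩, he⟩ := hA
  let Φ : A →L[ℝ] B := ⟨(φ : A →ₗ[ℝ] B), hφcont⟩
  have hbound : ∀ i, ‖φ (e i)‖ ≤ ‖Φ‖ * C := fun i => Φ.le_opNorm_of_le (hC i)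
  refine ⟨ι, inferInstance, inferInstance, inferInstance, fun i => φ (e i), ⟨_, hbound⟩, ?_⟩
  intro b hb
  have hbcl : b ∈ closure (Jᶜ ∩ Set.range φ) :=
    hφdense.open_subset_closure_inter hJc.isOpen_compl hb
  have hnotMem : ∀ a, φ a ∈ Jᶜ → a ∉ I := fun a ha haI => ha (hφIJ ⟨a, haI, rfl⟩)
  constructor
  · refine tendsto_norm_sub_of_mem_closure (T := fun i => AddMonoidHom.mulRight (φ (e i)))
      (K := ‖Φ‖ * C) (fun i x => ?_) ?_ hbcl
    · rw [mul_comm]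
      exact norm_mul_le_of_le le_rfl (hbound i)
    · rintro _ ⟨haJ, a, rfl⟩
      simpa using tendsto_norm_map_sub (f := (φ : A →+ B)) hφcont (he a (hnotMem a haJ)).1
  · refine tendsto_norm_sub_of_mem_closure (T := fun i => AddMonoidHom.mulLeft (φ (e i)))
      (K := ‖Φ‖ * C) (fun i x => ?_) ?_ hbcl
    · exact norm_mul_le_of_le (hbound i) le_rfl
    · rintro _ ⟨haJ, a, rfl⟩
      simpa using tendsto_norm_map_sub (f := (φ : A →+ B)) hφcont (he a (hnotMem a haJ)).2
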